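/- Let θ ∈ ℝ be irrational and set x_n = {nθ}, the fractional part of nθ. Then there exists a dense Gδ subset 𝒪 of the space C([0,1], ℝ) of continuous real-valued functions on [0,1] with the uniform norm, such that for every f ∈ 𝒪 the averages A_N = (1/N) ∑_{n=1}^{N} f(x_n) satisfy A_N > ∫₀¹ f(t) dt for infinitely many N and A_N < ∫₀¹ f(t) dt for infinitely many N. -/

import Mathlib

open MeasureTheory Filter

/-- The point `{nθ}` (fractional part of `nθ`) as an element of `[0,1]`. -/
noncomputable def fracPt (θ : ℝ) (n : ℕ) : unitInterval :=
  ⟨Int.fract ((n : ℝ) * θ),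
    Set.mem_Icc.mpr ⟨Int.fract_nonneg _, (Int.fract_lt_one _).le⟩⟩

open scoped Topology

section Discrepancy

variable {X : Type*} [TopologicalSpace X] [CompactSpace X] [MeasurableSpace X]
  [OpensMeasurableSpace X]

/-- The average of `f` over `x 1, …, x N` minus the integral of `f`, as a functional of `f`. -/
noncomputable def discrepancy (𝕜 : Type*) [RCLike 𝕜] (μ : Measure X) [IsProbabilityMeasure μ]
    (x : ℕ → X) (N : ℕ) : C(X, 𝕜) →L[𝕜] 𝕜 :=
  LinearMap.mkContinuous
    { toFun := fun f => (N : 𝕜)⁻¹ * ∑ n ∈ Finset.Icc 1 N, f (x n) - ∫ t, f t ∂μ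
      map_add' := fun f g => by
        have hf : Integrable (fun t => f t) μ :=
          f.continuous.integrable_of_hasCompactSupport (HasCompactSupport.of_compactSpace _)
        have hg : Integrable (fun t => g t) μ :=
          g.continuous.integrable_of_hasCompactSupport (HasCompactSupport.of_compactSpace _)
        simp only [ContinuousMap.add_apply, Finset.sum_add_distrib, integral_add hf hg]
        ring
      map_smul' := fun c f => by
        simp only [ContinuousMap.smul_apply, smul_eq_mul, ← Finset.mul_sum, integral_const_mul,
          RingHom.id_apply]
        ring }
    2 (fun f => by
      have hsum : ‖(N : 𝕜)⁻¹ * ∑ n ∈ Finset.Icc 1 N, f (x n)‖ ≤ ‖f‖ := by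
        rw [norm_mul, norm_inv, RCLike.norm_natCast]
        have h : ‖∑ n ∈ Finset.Icc 1 N, f (x n)‖ ≤ N * ‖f‖ := by
          simpa using norm_sum_le_of_le (Finset.Icc 1 N) fun n _ => f.norm_coe_le_norm (x n)
        rcases N.eq_zero_or_pos with rfl | hN
        · simp
        · exact (inv_mul_le_iff₀ (by exact_mod_cast hN)).2 h
      have h_integral : ‖∫ t, f t ∂μ‖ ≤ ‖f‖ := by
        simpa using norm_integral_le_of_norm_le_const (μ := μ) (.of_forall f.norm_coe_le_norm)
      calc _ ≤ _ := norm_sub_le _ _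
        _ ≤ 2 * ‖f‖ := by linarith)

theorem discrepancy_apply {𝕜 : Type*} [RCLike 𝕜] (μ : Measure X) [IsProbabilityMeasure μ]
    (x : ℕ → X) (N : ℕ) (f : C(X, 𝕜)) :
    discrepancy 𝕜 μ x N f = (N : 𝕜)⁻¹ * ∑ n ∈ Finset.Icc 1 N, f (x n) - ∫ t, f t ∂μ :=
  rfl

theorem norm_discrepancy_le {𝕜 : Type*} [RCLike 𝕜] (μ : Measure X) [IsProbabilityMeasure μ]
    (x : ℕ → X) (N : ℕ) : ‖discrepancy 𝕜 μ x N‖ ≤ 2 :=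
  LinearMap.mkContinuous_norm_le _ zero_le_two _

end Discrepancy

section Weyl

instance UnitAddCircle.isProbabilityMeasure_volume :
    IsProbabilityMeasure (volume : Measure UnitAddCircle) :=
  ⟨UnitAddCircle.measure_univ⟩

theorem tendsto_discrepancy_fourier {θ : ℝ} (hθ : Irrational θ) (k : ℤ) :
    Tendsto (fun N => discrepancy ℂ volume (fun n : ℕ => ((n * θ : ℝ) : UnitAddCircle)) N
      (fourier k)) atTop (𝓝 0) := by
  rcases eq_or_ne k 0 with rfl | hk
  · refine tendsto_const_nhds.congr' ?_
    filter_upwards [eventually_gt_atTop 0] with N hN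
    have : (N : ℂ) ≠ 0 := by exact_mod_cast hN.ne'
    simp [discrepancy_apply, this]
  have h_integral : ∫ t : UnitAddCircle, fourier k t = 0 :=
    integral_eq_zero_of_add_right_eq_neg (fourier_add_half_inv_index hk one_pos)
  set z : ℂ := fourier k ((θ : ℝ) : UnitAddCircle) with hz
  have hpow (n : ℕ) : fourier k ((n * θ : ℝ) : UnitAddCircle) = z ^ n := by
    rw [hz, fourier_coe_apply, fourier_coe_apply, ← Complex.exp_nat_mul]
    congr 1
    push_cast
    ring
  have hz1 : z ≠ 1 := by
    rw [hz, fourier_coe_apply, Ne, Complex.exp_eq_one_iff]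
    rintro ⟨m, hm⟩
    have h2 : (k : ℂ) * θ = m := by
      have : (2 * Real.pi * Complex.I : ℂ) ≠ 0 := Complex.two_pi_I_ne_zero
      apply mul_left_cancel₀ this
      simp only [Complex.ofReal_one, div_one] at hm
      linear_combination hm
    have h3 : (k : ℝ) * θ = m := by exact_mod_cast h2
    exact (hθ.intCast_mul hk).ne_int m h3
  have hnorm : ‖z‖ ≤ 1 := by
    rw [← fourier_norm (T := 1) k]
    exact (fourier k).norm_coe_le_norm _
  have hz1' : 0 < ‖z - 1‖ := norm_pos_iff.2 (sub_ne_zero.2 hz1)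
  refine squeeze_zero_norm (a := fun N : ℕ => (N : ℝ)⁻¹ * (2 / ‖z - 1‖)) (fun N => ?_) ?_
  · rw [discrepancy_apply, h_integral, sub_zero, norm_mul, norm_inv, RCLike.norm_natCast]
    gcongr
    simp only [hpow]
    rw [← Finset.Ico_add_one_right_eq_Icc, geom_sum_Ico hz1 (by omega), norm_div]
    gcongr
    calc _ ≤ _ := norm_sub_le _ _
      _ ≤ 1 + 1 := by
        gcongr <;> rw [norm_pow] <;> exact pow_le_one₀ (norm_nonneg _) hnorm
      _ = 2 := by norm_num
  · simpa using (tendsto_inv_atTop_nhds_zero_nat (𝕜 := ℝ)).mul_const (2 / ‖z - 1‖)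

/-- **Weyl's equidistribution theorem** for continuous functions on the circle. -/
theorem tendsto_discrepancy_unitAddCircle {θ : ℝ} (hθ : Irrational θ) (F : C(UnitAddCircle, ℂ)) :
    Tendsto (fun N => discrepancy ℂ volume (fun n : ℕ => ((n * θ : ℝ) : UnitAddCircle)) N F)
      atTop (𝓝 0) := by
  have hspan : ∀ G ∈ Submodule.span ℂ (Set.range (@fourier 1)), Tendsto (fun N =>
      discrepancy ℂ volume (fun n : ℕ => ((n * θ : ℝ) : UnitAddCircle)) N G) atTop (𝓝 0) := by
    intro G hG
    induction hG using Submodule.span_induction with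
    | mem G hG =>
      obtain ⟨k, rfl⟩ := hG
      exact tendsto_discrepancy_fourier hθ k
    | zero => simp
    | add G H _ _ hG hH => simpa using hG.add hH
    | smul c G _ hG => simpa using hG.const_mul c
  have hF : F ∈ closure (Submodule.span ℂ (Set.range (@fourier 1)) : Set C(UnitAddCircle, ℂ)) := by
    rw [← Submodule.topologicalClosure_coe, span_fourier_closure_eq_top]
    trivial
  rw [Metric.tendsto_nhds]
  intro ε hε
  obtain ⟨G, hG, hFG⟩ := Metric.mem_closure_iff.1 hF (ε / 4) (by positivity)
  filter_upwards [Metric.tendsto_nhds.1 (hspan G hG) (ε / 2) (by positivity)] with N hN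
  rw [dist_zero_right] at hN ⊢
  rw [dist_eq_norm] at hFG
  set L := discrepancy ℂ volume (fun n : ℕ => ((n * θ : ℝ) : UnitAddCircle)) N
  have h1 : ‖L (F - G)‖ ≤ 2 * ‖F - G‖ := L.le_of_opNorm_le (norm_discrepancy_le _ _ _) _
  have h2 : L F = L (F - G) + L G := by simp
  rw [h2]
  linarith [norm_add_le (L (F - G)) (L G)]

end Weyl

theorem tendsto_discrepancy_fracPt {θ : ℝ} (hθ : Irrational θ) (g : C(unitInterval, ℝ))
    (hg : g 0 = g 1) :
    Tendsto (fun N => discrepancy ℝ volume (fracPt θ) N g) atTop (𝓝 0) := by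
  let G : ℝ → ℂ := fun t => g (Set.projIcc 0 1 zero_le_one t)
  have hGc : Continuous G := by fun_prop
  have hcont : Continuous (AddCircle.liftIco (1 : ℝ) 0 G) :=
    AddCircle.liftIco_continuous (by simp [G, hg]) hGc.continuousOn
  have hval (n : ℕ) :
      AddCircle.liftIco (1 : ℝ) 0 G ((n * θ : ℝ) : UnitAddCircle) = g (fracPt θ n) := by
    have h : ((n * θ : ℝ) : UnitAddCircle) = (Int.fract (n * θ) : ℝ) := by
      rw [← Int.self_sub_floor]
      simp
    rw [h, AddCircle.liftIco_coe_apply (by simp [Int.fract_nonneg, Int.fract_lt_one])]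
    simp only [G, fracPt]
    rw [Set.projIcc_of_mem]
  have h_integral : ∫ t, AddCircle.liftIco (1 : ℝ) 0 G t = ((∫ t, g t : ℝ) : ℂ) := by
    have h1 : ∫ t : UnitAddCircle, AddCircle.liftIco (1 : ℝ) 0 G t = ∫ t in (0 : ℝ)..1, G t := by
      rw [← UnitAddCircle.intervalIntegral_preimage 0, zero_add]
      refine intervalIntegral.integral_congr_Ioo_of_le zero_le_one fun t ht => ?_
      exact AddCircle.liftIco_coe_apply (by simpa using ⟨ht.1.le, ht.2⟩)
    rw [h1, ← integral_complex_ofReal, intervalIntegral.integral_of_le zero_le_one,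
      ← integral_Icc_eq_integral_Ioc, ← integral_subtype measurableSet_Icc]
    simp [G]
  have key := tendsto_discrepancy_unitAddCircle hθ ⟨_, hcont⟩
  simp only [discrepancy_apply, ContinuousMap.coe_mk, hval, h_integral] at key ⊢
  refine tendsto_ofReal_iff.1 (key.congr fun N => ?_)
  push_cast
  rfl

theorem exists_bump_integral_lt (s : Finset unitInterval) {δ : ℝ} (hδ : 0 < δ) :
    ∃ b : C(unitInterval, ℝ), (∀ t ∈ s, b t = 1) ∧ (∀ t, b t ∈ Set.Icc (0 : ℝ) 1) ∧
      ∫ t, b t < δ := by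
  obtain ⟨U, hsU, hU, hUδ⟩ := Set.exists_isOpen_lt_of_lt (μ := volume) (s : Set unitInterval)
    (ENNReal.ofReal δ) (by simpa [s.finite_toSet.measure_zero] using hδ)
  obtain ⟨b, hb0, hb1, hb⟩ := exists_continuous_zero_one_of_isClosed hU.isClosed_compl
    s.finite_toSet.isClosed (Set.disjoint_compl_left_iff_subset.2 hsU)
  refine ⟨b, fun t ht => hb1 ht, hb, ?_⟩
  calc ∫ t, b t ≤ ∫ t, U.indicator 1 t := by
        refine integral_mono
          (b.continuous.integrable_of_hasCompactSupport (HasCompactSupport.of_compactSpace _))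
          ((integrable_const (1 : ℝ)).indicator hU.measurableSet) fun t => ?_
        by_cases ht : t ∈ U
        · simpa [ht] using (hb t).2
        · simpa [ht] using (hb0 ht).le
    _ = volume.real U := integral_indicator_one hU.measurableSet
    _ < δ := ENNReal.toReal_lt_of_lt_ofReal hUδ

theorem eventually_neg_lt_discrepancy_fracPt {θ : ℝ} (hθ : Irrational θ) (f : C(unitInterval, ℝ))
    {δ : ℝ} (hδ : 0 < δ) : ∀ᶠ N in atTop, -δ < discrepancy ℝ volume (fracPt θ) N f := by
  have hK := norm_nonneg f
  obtain ⟨b, hb1, hb, hbint⟩ := exists_bump_integral_lt {0, 1}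
    (δ := δ / (2 * (2 * ‖f‖ + 1))) (by positivity)
  let h : C(unitInterval, ℝ) := (f + ContinuousMap.const _ ‖f‖) * b
  have hnonneg (t) : 0 ≤ h t :=
    mul_nonneg (by simpa using neg_le_iff_add_nonneg.1 (f.neg_norm_le_apply t)) (hb t).1
  have h_integral : ∫ t, h t ≤ δ / 2 := by
    calc ∫ t, h t ≤ ∫ t, (2 * ‖f‖ + 1) * b t := by
          refine integral_mono
            (h.continuous.integrable_of_hasCompactSupport (HasCompactSupport.of_compactSpace _))
            ((b.continuous.integrable_of_hasCompactSupport
              (HasCompactSupport.of_compactSpace _)).const_mul _) fun t => ?_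
          refine mul_le_mul_of_nonneg_right ?_ (hb t).1
          have := f.apply_le_norm t
          simp only [ContinuousMap.add_apply, ContinuousMap.const_apply]
          linarith
      _ = (2 * ‖f‖ + 1) * ∫ t, b t := integral_const_mul _ _
      _ ≤ (2 * ‖f‖ + 1) * (δ / (2 * (2 * ‖f‖ + 1))) := by gcongr
      _ = δ / 2 := by field_simp
  have hlim := tendsto_discrepancy_fracPt hθ (f - h)
    (by simp [h, hb1 0 (by simp), hb1 1 (by simp)])
  filter_upwards [hlim.eventually_const_lt (show -(δ / 2) < 0 by linarith)] with N hN
  have hh : -(δ / 2) ≤ discrepancy ℝ volume (fracPt θ) N h := by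
    rw [discrepancy_apply]
    have : 0 ≤ (N : ℝ)⁻¹ * ∑ n ∈ Finset.Icc 1 N, h (fracPt θ n) :=
      mul_nonneg (by positivity) (Finset.sum_nonneg fun _ _ => hnonneg _)
    linarith
  rw [map_sub] at hN
  linarith

theorem exists_dist_lt_discrepancy_fracPt_pos {θ : ℝ} (hθ : Irrational θ)
    (f : C(unitInterval, ℝ)) {ε : ℝ} (hε : 0 < ε) (M : ℕ) :
    ∃ g, dist f g < ε ∧ ∃ N ≥ M, 0 < discrepancy ℝ volume (fracPt θ) N g := by
  obtain ⟨N, hN, hMN, hN0⟩ := ((eventually_neg_lt_discrepancy_fracPt hθ f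
    (show 0 < ε / 8 by positivity)).and
    ((eventually_ge_atTop M).and (eventually_gt_atTop 0))).exists
  obtain ⟨b, hb1, hb, hbint⟩ := exists_bump_integral_lt ((Finset.Icc 1 N).image (fracPt θ))
    (δ := 1 / 2) (by norm_num)
  have hbnorm : ‖b‖ ≤ 1 := (ContinuousMap.norm_le _ zero_le_one).2 fun t => by
    rw [Real.norm_of_nonneg (hb t).1]
    exact (hb t).2
  have hbN : 1 / 2 < discrepancy ℝ volume (fracPt θ) N b := by
    have hsum : ∑ n ∈ Finset.Icc 1 N, b (fracPt θ n) = N := by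
      rw [Finset.sum_congr rfl fun n hn => hb1 _ (Finset.mem_image_of_mem _ hn)]
      simp
    rw [discrepancy_apply, hsum, inv_mul_cancel₀ (by exact_mod_cast hN0.ne')]
    linarith
  refine ⟨f + (ε / 2) • b, ?_, N, hMN, ?_⟩
  · rw [dist_self_add_right, norm_smul, Real.norm_of_nonneg (by positivity)]
    nlinarith
  · rw [map_add, map_smul, smul_eq_mul]
    nlinarith

/-- A property of `N` holding frequently is generic if it is open in `f` for each `N` and holds for
arbitrarily large `N` after arbitrarily small perturbations of `f`. -/
theorem dense_isGδ_frequently {E : Type*} [MetricSpace E] [CompleteSpace E] {p : ℕ → E → Prop}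
    (hopen : ∀ N, IsOpen {f | p N f})
    (hdense : ∀ f, ∀ ε > 0, ∀ M, ∃ g, dist f g < ε ∧ ∃ N ≥ M, p N g) :
    Dense {f | ∃ᶠ N in atTop, p N f} ∧ IsGδ {f | ∃ᶠ N in atTop, p N f} := by
  have heq : {f | ∃ᶠ N in atTop, p N f} = ⋂ M : ℕ, {f | ∃ N ≥ M, p N f} := by
    ext f
    simp [frequently_atTop]
  have ho (M : ℕ) : IsOpen {f | ∃ N ≥ M, p N f} := by
    have : {f | ∃ N ≥ M, p N f} = ⋃ N ≥ M, {f | p N f} := by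
      ext f
      simp
    rw [this]
    exact isOpen_biUnion fun N _ => hopen N
  rw [heq]
  refine ⟨dense_iInter_of_isOpen ho fun M => Metric.dense_iff.2 fun f ε hε => ?_,
    .iInter_of_isOpen ho⟩
  obtain ⟨g, hfg, hg⟩ := hdense f ε hε M
  exact ⟨g, by rwa [Metric.mem_ball'], hg⟩

theorem stmt_18 (θ : ℝ) (hθ : Irrational θ) :
    ∃ 𝒪 : Set C(unitInterval, ℝ), Dense 𝒪 ∧ IsGδ 𝒪 ∧
      ∀ f ∈ 𝒪,
        (∃ᶠ N : ℕ in atTop,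
          (N : ℝ)⁻¹ * ∑ n ∈ Finset.Icc 1 N, f (fracPt θ n) > ∫ t, f t) ∧
        (∃ᶠ N : ℕ in atTop,
          (N : ℝ)⁻¹ * ∑ n ∈ Finset.Icc 1 N, f (fracPt θ n) < ∫ t, f t) := by
  obtain ⟨hpos_dense, hpos_Gδ⟩ := dense_isGδ_frequently
    (p := fun N f => 0 < discrepancy ℝ volume (fracPt θ) N f)
    (fun N => isOpen_lt continuous_const (discrepancy ℝ volume (fracPt θ) N).continuous)
    fun f ε hε M => exists_dist_lt_discrepancy_fracPt_pos hθ f hε M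
  obtain ⟨hneg_dense, hneg_Gδ⟩ := dense_isGδ_frequently
    (p := fun N f => discrepancy ℝ volume (fracPt θ) N f < 0)
    (fun N => isOpen_lt (discrepancy ℝ volume (fracPt θ) N).continuous continuous_const)
    fun f ε hε M => by
      obtain ⟨g, hg, N, hMN, hN⟩ := exists_dist_lt_discrepancy_fracPt_pos hθ (-f) hε M
      exact ⟨-g, by rwa [← dist_neg_neg, neg_neg], N, hMN, by simpa using hN⟩
  refine ⟨_, hpos_dense.inter_of_Gδ hpos_Gδ hneg_Gδ hneg_dense, hpos_Gδ.inter hneg_Gδ,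
    fun f hf => ⟨?_, ?_⟩⟩
  · exact hf.1.mono fun N hN => sub_pos.1 hN
  · exact hf.2.mono fun N hN => sub_neg.1 hN
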